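/- Let Y be a symmetric positive definite g×g real matrix and f_Y(t,x) = √(det Y) · Σ_{m ∈ ℤ^g} exp(-π t ‖x - m‖_Y²) where ‖x‖_Y² = xᵀYx. Then for every t > 0, ∫_{[0,1]^g} ln f_Y(t,x) dx ≤ -(g/2) ln t. -/

import Mathlib

open MeasureTheory Real Matrix

noncomputable def coeZ {g : ℕ} (m : Fin g → ℤ) : Fin g → ℝ := fun i => (m i : ℝ)

noncomputable def normY {g : ℕ} (Y : Matrix (Fin g) (Fin g) ℝ) (x : Fin g → ℝ) : ℝ :=
  Real.sqrt (x ⬝ᵥ Y.mulVec x)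

noncomputable def psi {g : ℕ} (Y : Matrix (Fin g) (Fin g) ℝ) (x : Fin g → ℝ) : ℝ :=
  ⨅ m : Fin g → ℤ, normY Y (x - coeZ m)

noncomputable def mu {g : ℕ} (Y : Matrix (Fin g) (Fin g) ℝ) : ℝ :=
  ⨆ x : Fin g → ℝ, psi Y x

noncomputable def lam1 {g : ℕ} (Y : Matrix (Fin g) (Fin g) ℝ) : ℝ :=
  ⨅ m : {m : Fin g → ℤ // m ≠ 0}, normY Y (coeZ (m : Fin g → ℤ))

noncomputable def fY {g : ℕ} (Y : Matrix (Fin g) (Fin g) ℝ) (t : ℝ) (x : Fin g → ℝ) : ℝ :=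
  Real.sqrt Y.det * ∑' m : Fin g → ℤ, Real.exp (-π * t * normY Y (x - coeZ m) ^ 2)

noncomputable def cube (g : ℕ) : Set (Fin g → ℝ) := Set.univ.pi fun _ => Set.Icc (0:ℝ) 1

open scoped ENNReal

theorem lintegral_exp_neg_mul_dotProduct_self {ι : Type*} [Fintype ι] {b : ℝ} (hb : 0 < b) :
    ∫⁻ v : ι → ℝ, ENNReal.ofReal (Real.exp (-b * (v ⬝ᵥ v))) =
      ENNReal.ofReal (√(π / b) ^ Fintype.card ι) := by
  have hprod (v : ι → ℝ) : Real.exp (-b * (v ⬝ᵥ v)) = ∏ i, Real.exp (-b * v i ^ 2) := by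
    rw [← Real.exp_sum, dotProduct, Finset.mul_sum]
    simp only [sq]
  have hint : Integrable fun v : ι → ℝ => ∏ i, Real.exp (-b * v i ^ 2) :=
    Integrable.fintype_prod fun _ => integrable_exp_neg_mul_sq hb
  simp_rw [hprod]
  rw [← ofReal_integral_eq_lintegral_ofReal hint
      (ae_of_all _ fun v => Finset.prod_nonneg fun i _ => (Real.exp_pos _).le),
    integral_fintype_prod_volume_eq_pow (fun x : ℝ => Real.exp (-b * x ^ 2)), integral_gaussian]

open scoped MatrixOrder in
theorem Matrix.PosDef.exists_transpose_mul_self_eq {ι : Type*} [Fintype ι] [DecidableEq ι]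
    {Y : Matrix ι ι ℝ} (hY : Y.PosDef) : ∃ A : Matrix ι ι ℝ, Y = Aᵀ * A := by
  obtain ⟨A, hA⟩ := CStarAlgebra.nonneg_iff_eq_star_mul_self.mp hY.posSemidef.nonneg
  exact ⟨A, by rwa [star_eq_conjTranspose, conjTranspose_eq_transpose_of_trivial] at hA⟩

theorem lintegral_exp_neg_mul_posDef {ι : Type*} [Fintype ι] [DecidableEq ι]
    {Y : Matrix ι ι ℝ} (hY : Y.PosDef) {b : ℝ} (hb : 0 < b) :
    ∫⁻ v : ι → ℝ, ENNReal.ofReal (Real.exp (-b * (v ⬝ᵥ Y.mulVec v))) =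
      ENNReal.ofReal ((√Y.det)⁻¹ * √(π / b) ^ Fintype.card ι) := by
  obtain ⟨A, rfl⟩ := hY.exists_transpose_mul_self_eq
  have hdet : A.det ≠ 0 := fun h => hY.det_pos.ne' (by simp [h])
  have hmap := Real.map_matrix_volume_pi_eq_smul_volume_pi hdet
  have hquad (v : ι → ℝ) : v ⬝ᵥ (Aᵀ * A).mulVec v = toLin' A v ⬝ᵥ toLin' A v := by
    rw [toLin'_apply, ← mulVec_mulVec, dotProduct_mulVec, vecMul_transpose]
  have hmeas : Measurable fun v : ι → ℝ => ENNReal.ofReal (Real.exp (-b * (v ⬝ᵥ v))) := by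
    unfold dotProduct
    fun_prop
  simp_rw [hquad]
  rw [← lintegral_map (g := toLin' A) hmeas (toLin' A).continuous_of_finiteDimensional.measurable,
    hmap, lintegral_smul_measure, lintegral_exp_neg_mul_dotProduct_self hb, smul_eq_mul,
    ← ENNReal.ofReal_mul (abs_nonneg _), det_mul, det_transpose, Real.sqrt_mul_self_eq_abs,
    abs_inv]

theorem normY_sq {g : ℕ} {Y : Matrix (Fin g) (Fin g) ℝ} (hY : Y.PosDef) (x : Fin g → ℝ) :
    normY Y x ^ 2 = x ⬝ᵥ Y.mulVec x :=
  Real.sq_sqrt (by simpa using hY.posSemidef.dotProduct_mulVec_nonneg x)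

theorem continuous_normY {g : ℕ} (Y : Matrix (Fin g) (Fin g) ℝ) : Continuous (normY Y) := by
  unfold normY
  fun_prop

/-- The integer vectors, as the lattice spanned by the standard basis. -/
noncomputable def intVectorEquiv (g : ℕ) :
    (Fin g → ℤ) ≃ (Submodule.span ℤ (Set.range (Pi.basisFun ℝ (Fin g)))).toAddSubgroup :=
  ((Pi.basisFun ℝ (Fin g)).restrictScalars ℤ).equivFun.symm.toEquiv

theorem coe_intVectorEquiv {g : ℕ} (m : Fin g → ℤ) :
    (intVectorEquiv g m : Fin g → ℝ) = coeZ m := by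
  ext i
  simp [intVectorEquiv, Module.Basis.equivFun_symm_apply, coeZ, Pi.single_apply]

theorem lintegral_cube_tsum_sub {g : ℕ} {f : (Fin g → ℝ) → ℝ≥0∞} (hf : Measurable f) :
    ∫⁻ x in cube g, ∑' m : Fin g → ℤ, f (x - coeZ m) = ∫⁻ x, f x := by
  have := (intVectorEquiv g).symm.injective.countable
  have hcube : cube g =ᵐ[volume] ZSpan.fundamentalDomain (Pi.basisFun ℝ (Fin g)) := by
    rw [ZSpan.fundamentalDomain_pi_basisFun]
    exact (Measure.pi_Ico_ae_eq_pi_Icc (μ := fun _ : Fin g => (volume : Measure ℝ))).symm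
  rw [lintegral_tsum fun m => by fun_prop,
    (ZSpan.isAddFundamentalDomain' (Pi.basisFun ℝ (Fin g)) volume).lintegral_eq_tsum' f,
    ← (intVectorEquiv g).tsum_eq]
  refine tsum_congr fun m => ?_
  rw [setLIntegral_congr hcube]
  simp only [AddSubgroup.vadd_def, vadd_eq_add, NegMemClass.coe_neg, coe_intVectorEquiv,
    neg_add_eq_sub]

theorem fY_eq_toReal {g : ℕ} (Y : Matrix (Fin g) (Fin g) ℝ) (t : ℝ) (x : Fin g → ℝ) :
    fY Y t x = √Y.det * (∑' m : Fin g → ℤ,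
      ENNReal.ofReal (Real.exp (-π * t * normY Y (x - coeZ m) ^ 2))).toReal := by
  rw [ENNReal.tsum_toReal_eq fun _ => ENNReal.ofReal_ne_top]
  simp only [ENNReal.toReal_ofReal (Real.exp_pos _).le, fY]

theorem measurable_tsum_ofReal_exp {g : ℕ} (Y : Matrix (Fin g) (Fin g) ℝ) (t : ℝ) :
    Measurable fun x : Fin g → ℝ => ∑' m : Fin g → ℤ,
      ENNReal.ofReal (Real.exp (-π * t * normY Y (x - coeZ m) ^ 2)) := by
  have := (continuous_normY Y).measurable
  exact Measurable.tsum fun m => by fun_prop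

theorem measurable_fY {g : ℕ} (Y : Matrix (Fin g) (Fin g) ℝ) (t : ℝ) :
    Measurable (fY Y t) := by
  rw [funext (fY_eq_toReal Y t)]
  exact (measurable_tsum_ofReal_exp Y t).ennreal_toReal.const_mul _

theorem lintegral_cube_tsum_ofReal_exp {g : ℕ} {Y : Matrix (Fin g) (Fin g) ℝ} (hY : Y.PosDef)
    {t : ℝ} (ht : 0 < t) :
    ∫⁻ x in cube g, ∑' m : Fin g → ℤ,
        ENNReal.ofReal (Real.exp (-π * t * normY Y (x - coeZ m) ^ 2)) =
      ENNReal.ofReal ((√Y.det)⁻¹ * √t⁻¹ ^ g) := by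
  have hmeas := (continuous_normY Y).measurable
  rw [lintegral_cube_tsum_sub
    (f := fun x => ENNReal.ofReal (Real.exp (-π * t * normY Y x ^ 2))) (by fun_prop)]
  simp_rw [normY_sq hY, neg_mul π t]
  rw [lintegral_exp_neg_mul_posDef hY (by positivity), Fintype.card_fin,
    div_mul_cancel_left₀ Real.pi_ne_zero]

theorem ae_tsum_ofReal_exp_lt_top {g : ℕ} {Y : Matrix (Fin g) (Fin g) ℝ} (hY : Y.PosDef)
    {t : ℝ} (ht : 0 < t) :
    ∀ᵐ x ∂volume.restrict (cube g), ∑' m : Fin g → ℤ,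
      ENNReal.ofReal (Real.exp (-π * t * normY Y (x - coeZ m) ^ 2)) < ∞ :=
  ae_lt_top (measurable_tsum_ofReal_exp Y t) <| by
    rw [lintegral_cube_tsum_ofReal_exp hY ht]
    exact ENNReal.ofReal_ne_top

theorem integrableOn_fY {g : ℕ} {Y : Matrix (Fin g) (Fin g) ℝ} (hY : Y.PosDef)
    {t : ℝ} (ht : 0 < t) : IntegrableOn (fY Y t) (cube g) := by
  rw [funext (fY_eq_toReal Y t)]
  refine (integrable_toReal_of_lintegral_ne_top
    (measurable_tsum_ofReal_exp Y t).aemeasurable ?_).const_mul _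
  rw [lintegral_cube_tsum_ofReal_exp hY ht]
  exact ENNReal.ofReal_ne_top

theorem integral_fY {g : ℕ} {Y : Matrix (Fin g) (Fin g) ℝ} (hY : Y.PosDef)
    {t : ℝ} (ht : 0 < t) : ∫ x in cube g, fY Y t x = √t⁻¹ ^ g := by
  have hdet : 0 < √Y.det := Real.sqrt_pos.mpr hY.det_pos
  simp_rw [fY_eq_toReal]
  rw [integral_const_mul, integral_toReal (measurable_tsum_ofReal_exp Y t).aemeasurable
      (ae_tsum_ofReal_exp_lt_top hY ht), lintegral_cube_tsum_ofReal_exp hY ht,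
    ENNReal.toReal_ofReal (by positivity), mul_inv_cancel_left₀ hdet.ne']

theorem ae_exp_le_fY {g : ℕ} {Y : Matrix (Fin g) (Fin g) ℝ} (hY : Y.PosDef)
    {t : ℝ} (ht : 0 < t) :
    ∀ᵐ x ∂volume.restrict (cube g),
      √Y.det * Real.exp (-π * t * normY Y x ^ 2) ≤ fY Y t x := by
  filter_upwards [ae_tsum_ofReal_exp_lt_top hY ht] with x hx
  rw [fY_eq_toReal]
  refine mul_le_mul_of_nonneg_left ?_ (Real.sqrt_nonneg _)
  rw [← ENNReal.ofReal_le_iff_le_toReal hx.ne]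
  have hzero : x - coeZ 0 = x := by ext; simp [coeZ]
  simpa only [hzero] using ENNReal.le_tsum (f := fun m : Fin g → ℤ =>
    ENNReal.ofReal (Real.exp (-π * t * normY Y (x - coeZ m) ^ 2))) 0

theorem isCompact_cube (g : ℕ) : IsCompact (cube g) :=
  isCompact_univ_pi fun _ => isCompact_Icc

theorem volume_cube (g : ℕ) : volume (cube g) = 1 := by
  rw [cube, volume_pi_pi]
  simp

theorem integrableOn_log_fY {g : ℕ} {Y : Matrix (Fin g) (Fin g) ℝ} (hY : Y.PosDef)
    {t : ℝ} (ht : 0 < t) : IntegrableOn (fun x => Real.log (fY Y t x)) (cube g) := by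
  have hdet : 0 < √Y.det := Real.sqrt_pos.mpr hY.det_pos
  have hcont := continuous_normY Y
  have hlower : IntegrableOn (fun x => Real.log √Y.det + -π * t * normY Y x ^ 2) (cube g) :=
    ContinuousOn.integrableOn_compact (isCompact_cube g) (by fun_prop)
  refine integrable_of_le_of_le (measurable_fY Y t).log.aestronglyMeasurable ?_ ?_ hlower
    (integrableOn_fY hY ht)
  · filter_upwards [ae_exp_le_fY hY ht] with x hx
    rw [← Real.log_exp (-π * t * normY Y x ^ 2), ← Real.log_mul hdet.ne' (Real.exp_ne_zero _)]
    exact Real.log_le_log (by positivity) hx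
  · filter_upwards [ae_exp_le_fY hY ht] with x hx
    exact Real.log_le_self (le_trans (by positivity) hx)

theorem integral_log_fY_le {g : ℕ} (hg : 1 ≤ g) (Y : Matrix (Fin g) (Fin g) ℝ)
    (hsymm : Y.IsSymm) (hY : Y.PosDef) (t : ℝ) (ht : 0 < t) :
    ∫ x in cube g, Real.log (fY Y t x) ≤ -(g / 2 : ℝ) * Real.log t := by
  have : IsProbabilityMeasure (volume.restrict (cube g)) := ⟨by simp [volume_cube]⟩
  have hdet : 0 < √Y.det := Real.sqrt_pos.mpr hY.det_pos
  set c : ℝ := √t⁻¹ ^ g with hc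
  have hcpos : 0 < c := by positivity
  have hlogc : Real.log c = -(g / 2 : ℝ) * Real.log t := by
    rw [hc, Real.log_pow, Real.log_sqrt (by positivity), Real.log_inv]
    ring
  have hint : Integrable (fun x => fY Y t x / c) (volume.restrict (cube g)) :=
    (integrableOn_fY hY ht).div_const c
  calc ∫ x in cube g, Real.log (fY Y t x)
      ≤ ∫ x in cube g, (fY Y t x / c + (Real.log c - 1)) := by
        refine integral_mono_ae (integrableOn_log_fY hY ht)
          (hint.add (integrable_const _)) ?_
        filter_upwards [ae_exp_le_fY hY ht] with x hx
        have hpos : 0 < fY Y t x := lt_of_lt_of_le (by positivity) hx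
        have := Real.log_le_sub_one_of_pos (div_pos hpos hcpos)
        rw [Real.log_div hpos.ne' hcpos.ne'] at this
        linarith
    _ = -(g / 2 : ℝ) * Real.log t := by
        rw [integral_add hint (integrable_const _), integral_div, integral_fY hY ht, ← hc,
          div_self hcpos.ne', integral_const, ← hlogc]
        simp
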